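/- arXiv:1708.03825 — 6 statements merged into one kernel-verified Lean document; each statement's English description precedes it below -/
import Mathlib

section
/- Fix an integer K ≥ 1, an integer K₁ ≥ 0, and a real ζ > 0. There exist a constant C > 0 and an integer n₀ such that for every integer n ≥ n₀, all nonnegative reals a₁, …, a_K with a = a₁ + ⋯ + a_K ≤ ζ, and all nonnegative integers N₁, …, N_K satisfying |N_j − n·a_j| ≤ K₁ for every j, setting N = N₁ + ⋯ + N_K, one has |log(N!/(N₁!⋯N_K!)) − n·(a·log a − Σ_{j=1}^K a_j·log a_j)| ≤ C·log n, with the convention 0·log 0 = 0. -/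
/-- Upper Stirling-type bound for `log m!`. -/
theorem log_factorial_le_mul_log_sub_add (m : ℕ) :
    Real.log (m.factorial : ℝ) ≤ m * Real.log m - m + 1 + Real.log m := by
  induction m with
  | zero => simp
  | succ m ih =>
    rcases Nat.eq_zero_or_pos m with rfl | hm
    · simp
    have hm' : (0 : ℝ) < m := by exact_mod_cast hm
    have hlog := Real.one_sub_inv_le_log_of_pos (x := ((m : ℝ) + 1) / m) (by positivity)
    rw [Real.log_div (by positivity) (by positivity), inv_div] at hlog
    have hmul := mul_le_mul_of_nonneg_left hlog (by positivity : (0 : ℝ) ≤ m + 1)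
    have heq : ((m : ℝ) + 1) * (1 - m / (m + 1)) = 1 := by field_simp; ring
    rw [heq] at hmul
    rw [Nat.factorial_succ]
    push_cast
    rw [Real.log_mul (by positivity) (by positivity)]
    linarith

/-- Lower Stirling-type bound for `log m!`. -/
theorem mul_log_sub_le_log_factorial (m : ℕ) :
    m * Real.log m - m ≤ Real.log (m.factorial : ℝ) := by
  rcases Nat.eq_zero_or_pos m with rfl | hm
  · simp
  have hm' : (1 : ℝ) ≤ m := by exact_mod_cast hm
  have h := Stirling.le_log_factorial_stirling hm.ne'
  have h1 := Real.log_nonneg hm'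
  have h2 : 0 ≤ Real.log (2 * Real.pi) :=
    Real.log_nonneg (by linarith [Real.pi_gt_three])
  linarith

/-- The tangent line inequality for the convex function `t ↦ t log t - t`. -/
theorem mul_log_sub_sub_le {u v : ℝ} (hu : 0 < u) (hv : 0 ≤ v) :
    (u * Real.log u - u) - (v * Real.log v - v) ≤ (u - v) * Real.log u := by
  rcases hv.eq_or_lt with rfl | hv
  · simp; linarith
  have hlog := Real.log_le_sub_one_of_pos (x := u / v) (by positivity)
  rw [Real.log_div hu.ne' hv.ne'] at hlog
  have hmul := mul_le_mul_of_nonneg_left hlog hv.le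
  have heq : v * (u / v - 1) = u - v := by field_simp
  rw [heq] at hmul
  linarith

theorem mul_log_sub_sub_le_of_abs_le {u v B M : ℝ} (hu : 0 ≤ u) (hv : 0 ≤ v)
    (huv : |u - v| ≤ B) (huM : u ≤ M) (hM : 1 ≤ M) :
    (u * Real.log u - u) - (v * Real.log v - v) ≤ 1 + B * Real.log M := by
  have hB : 0 ≤ B := (abs_nonneg _).trans huv
  have hlogM := Real.log_nonneg hM
  have hBM := mul_nonneg hB hlogM
  rcases le_or_gt 1 u with h1 | h1
  · have h := mul_log_sub_sub_le (by linarith : 0 < u) hv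
    have h2 : (u - v) * Real.log u ≤ B * Real.log M :=
      mul_le_mul ((le_abs_self _).trans huv) (Real.log_le_log (by linarith) huM)
        (Real.log_nonneg h1) hB
    linarith
  · have h := mul_log_sub_sub_le one_pos hv
    have h2 : u * Real.log u ≤ 0 := Real.mul_log_nonpos hu h1.le
    simp only [Real.log_one] at h
    linarith

theorem abs_log_factorial_sub_le {m : ℕ} {y B M : ℝ} (hy : 0 ≤ y)
    (hmy : |(m : ℝ) - y| ≤ B) (hmM : (m : ℝ) ≤ M) (hyM : y ≤ M) (hM : 1 ≤ M) :
    |Real.log (m.factorial : ℝ) - (y * Real.log y - y)| ≤ 2 + (B + 1) * Real.log M := by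
  have hm : (0 : ℝ) ≤ m := m.cast_nonneg
  have h1 := log_factorial_le_mul_log_sub_add m
  have h2 := mul_log_sub_le_log_factorial m
  have h3 := mul_log_sub_sub_le_of_abs_le hm hy hmy hmM hM
  have h4 := mul_log_sub_sub_le_of_abs_le hy hm (abs_sub_comm (m : ℝ) y ▸ hmy) hyM hM
  have hlogM := Real.log_nonneg hM
  have h5 : Real.log m ≤ Real.log M := by
    rcases Nat.eq_zero_or_pos m with rfl | h
    · simpa using hlogM
    · exact Real.log_le_log (by exact_mod_cast h) hmM
  rw [abs_le]
  constructor <;> linarith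

/-- Rescaled estimate of `log m!` for `m` within bounded distance of `n * x`, uniform in
`x ∈ [0, ζ]`. -/
theorem exists_abs_log_factorial_sub_rescaled_le {B ζ : ℝ} (hB : 0 ≤ B) (hζ : 0 < ζ) :
    ∃ C : ℝ, 0 < C ∧ ∀ n : ℕ, 3 ≤ n → ∀ x : ℝ, 0 ≤ x → x ≤ ζ → ∀ m : ℕ,
      |(m : ℝ) - n * x| ≤ B →
      |Real.log (m.factorial : ℝ) - (n * (x * Real.log x) + x * (n * Real.log n - n))|
        ≤ C * Real.log n := by
  have hL : 0 ≤ Real.log (ζ + B + 1) := Real.log_nonneg (by linarith)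
  refine ⟨2 + (B + 1) * (1 + Real.log (ζ + B + 1)), by positivity, ?_⟩
  intro n hn x hx hxζ m hm
  have hn' : (3 : ℝ) ≤ n := by exact_mod_cast hn
  have hlogn : 1 ≤ Real.log n := by
    rw [Real.le_log_iff_exp_le (by linarith)]
    linarith [Real.exp_one_lt_three]
  have hnx : n * x ≤ n * ζ := by gcongr
  have hnB : B ≤ n * B := le_mul_of_one_le_left hB (by linarith)
  have hm2 := (abs_le.mp hm).2
  have hnζ : 0 ≤ n * ζ := by positivity
  have key := abs_log_factorial_sub_le (M := n * (ζ + B + 1)) (by positivity) hm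
    (by linarith) (by linarith) (by linarith)
  rw [Real.log_mul (x := (n : ℝ)) (y := ζ + B + 1) (by linarith) (by linarith)] at key
  have heq : n * x * Real.log (n * x) - n * x
      = n * (x * Real.log x) + x * (n * Real.log n - n) := by
    rcases hx.eq_or_lt with rfl | hx
    · simp
    · rw [Real.log_mul (by linarith) hx.ne']; ring
  rw [heq] at key
  have h1 : Real.log (ζ + B + 1) ≤ Real.log (ζ + B + 1) * Real.log n :=
    le_mul_of_one_le_right hL hlogn
  have h2 := mul_le_mul_of_nonneg_left h1 (by linarith : 0 ≤ B + 1)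
  linarith

theorem log_multinomial {ι : Type*} (s : Finset ι) (f : ι → ℕ) :
    Real.log (Nat.multinomial s f)
      = Real.log ((∑ i ∈ s, f i).factorial : ℝ) - ∑ i ∈ s, Real.log ((f i).factorial : ℝ) := by
  have hne : ∀ i ∈ s, ((f i).factorial : ℝ) ≠ 0 := fun i _ => by positivity
  have hpos : (Nat.multinomial s f : ℝ) ≠ 0 := by
    exact_mod_cast (Nat.multinomial_pos s f).ne'
  rw [← Nat.multinomial_spec, Nat.cast_mul, Nat.cast_prod,
    Real.log_mul (Finset.prod_ne_zero_iff.mpr hne) hpos, Real.log_prod hne]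
  ring

/-- Fix `K ≥ 1`, `K₁ ≥ 0` and a real `ζ > 0`. There are `C > 0` and
`n₀` such that for all `n ≥ n₀`, all nonnegative reals `a₁, …, a_K` with
`a = a₁ + ⋯ + a_K ≤ ζ` and all nonnegative integers `N₁, …, N_K` with
`|N_j − n·a_j| ≤ K₁` for every `j`, setting `N = N₁ + ⋯ + N_K`,
`|log(N!/(N₁!⋯N_K!)) − n·(a log a − Σ_j a_j log a_j)| ≤ C log n`
(convention `0 · log 0 = 0`, automatic since `Real.log 0 = 0`). -/
theorem stmt2 (K : ℕ) (hK : 1 ≤ K) (K₁ : ℕ) (ζ : ℝ) (hζ : 0 < ζ) :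
    ∃ C : ℝ, 0 < C ∧ ∃ n₀ : ℕ, ∀ n : ℕ, n₀ ≤ n →
      ∀ a : Fin K → ℝ, (∀ j, 0 ≤ a j) → (∑ j, a j) ≤ ζ →
      ∀ Nj : Fin K → ℕ, (∀ j, |(Nj j : ℝ) - (n : ℝ) * a j| ≤ (K₁ : ℝ)) →
      |Real.log (Nat.multinomial Finset.univ Nj) -
          (n : ℝ) * ((∑ j, a j) * Real.log (∑ j, a j)
            - ∑ j, a j * Real.log (a j))|
        ≤ C * Real.log n := by
  have hK' : (1 : ℝ) ≤ K := by exact_mod_cast hK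
  have hK₁ : (0 : ℝ) ≤ K₁ := K₁.cast_nonneg
  obtain ⟨C, hC, h⟩ :=
    exists_abs_log_factorial_sub_rescaled_le (B := K * K₁) (by positivity) hζ
  refine ⟨(1 + K) * C, by positivity, 3, ?_⟩
  intro n hn a ha haζ Nj hNj
  have hsum := h n hn (∑ j, a j) (Finset.sum_nonneg fun j _ => ha j) haζ (∑ j, Nj j) (by
    push_cast
    rw [Finset.mul_sum, ← Finset.sum_sub_distrib]
    refine (Finset.abs_sum_le_sum_abs _ _).trans ?_
    simpa using Finset.sum_le_sum fun j (_ : j ∈ Finset.univ) => hNj j)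
  have hterm : ∀ j, |Real.log ((Nj j).factorial : ℝ)
      - (n * (a j * Real.log (a j)) + a j * (n * Real.log n - n))| ≤ C * Real.log n :=
    fun j => h n hn (a j) (ha j)
      ((Finset.single_le_sum (fun i _ => ha i) (Finset.mem_univ j)).trans haζ) (Nj j)
      ((hNj j).trans (le_mul_of_one_le_left hK₁ hK'))
  have hterms : |∑ j, (Real.log ((Nj j).factorial : ℝ)
      - (n * (a j * Real.log (a j)) + a j * (n * Real.log n - n)))| ≤ K * (C * Real.log n) := by
    refine (Finset.abs_sum_le_sum_abs _ _).trans ?_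
    simpa using Finset.sum_le_sum fun j (_ : j ∈ Finset.univ) => hterm j
  rw [Finset.sum_sub_distrib, Finset.sum_add_distrib, ← Finset.mul_sum, ← Finset.sum_mul]
    at hterms
  rw [log_multinomial]
  rw [abs_le] at hsum hterms ⊢
  constructor <;> linarith
end

section
/- Let G be a finite tree with N vertices, let v₀ be a centroid of G, and let v₀, v₁, …, v_k (k ≥ 1) be a path in G, i.e., distinct vertices with v_{i−1} adjacent to v_i for each i. Then for every j with 1 ≤ j ≤ k, the number of descendants of v_j relative to root v_{j−1} is at most N/2 − j + 1, i.e., n_{v_{j−1}}(v_j) ≤ N/2 − j + 1. -/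
/-- `x` is a centroid of the graph `G`: every connected component of the
subgraph induced on the complement of `{x}` has at most `N/2` vertices,
where `N` is the number of vertices of `G`. -/
def IsCentroid {V : Type*} [Fintype V] (G : SimpleGraph V) (x : V) : Prop :=
  ∀ c : (G.induce ({x}ᶜ : Set V)).ConnectedComponent,
    (c.supp.ncard : ℝ) ≤ (Fintype.card V : ℝ) / 2

/-- The set of descendants of `w` relative to the root `u` in the graph `G`:
vertices `z` such that `w` lies on every path (hence on the unique path, when
`G` is a tree) from `u` to `z`.  In particular `w` is a descendant of itself. -/
def descendants {V : Type*} (G : SimpleGraph V) (u w : V) : Set V :=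
  {z : V | ∀ p : G.Walk u z, p.IsPath → w ∈ p.support}

/-- In an acyclic graph, the descendants of `w` relative to a neighbour `u` include every
endpoint of a walk from `w` that avoids `u`. -/
lemma SimpleGraph.IsAcyclic.mem_descendants_of_walk {V : Type*} {G : SimpleGraph V}
    (hG : G.IsAcyclic) {u w z : V} (h : G.Adj u w) (q : G.Walk w z) (hq : u ∉ q.support) :
    z ∈ descendants G u w := by
  classical
  intro p hp
  have hpath : (SimpleGraph.Walk.cons h q.bypass).IsPath :=
    q.bypass_isPath.cons fun hu => hq (q.support_bypass_subset_support hu)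
  have heq := congrArg Subtype.val ((hG.subsingleton_path u z).elim ⟨p, hp⟩ ⟨_, hpath⟩)
  simp only at heq
  simp [heq]

/-- In a connected graph, every descendant of `w` relative to `u ≠ w` is reached from `w`
by a walk that avoids `u`. -/
lemma SimpleGraph.Connected.exists_walk_of_mem_descendants {V : Type*} {G : SimpleGraph V}
    (hG : G.Connected) {u w z : V} (hne : u ≠ w) (hz : z ∈ descendants G u w) :
    ∃ q : G.Walk w z, u ∉ q.support := by
  classical
  obtain ⟨p, hp⟩ := (hG u z).exists_isPath
  have hw : w ∈ p.reverse.support := by simpa using hz p hp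
  exact ⟨(p.reverse.takeUntil w hw).reverse, by
    simpa using SimpleGraph.Walk.endpoint_notMem_support_takeUntil hp.reverse hw hne⟩

/-- The descendants of a neighbour of a centroid make up at most half of the vertices. -/
lemma IsCentroid.ncard_descendants_le {V : Type*} [Fintype V] {G : SimpleGraph V}
    (hG : G.Connected) {u w : V} (hu : IsCentroid G u) (hne : u ≠ w) :
    ((descendants G u w).ncard : ℝ) ≤ (Fintype.card V : ℝ) / 2 := by
  let c := (G.induce ({u}ᶜ : Set V)).connectedComponentMk ⟨w, hne.symm⟩
  have hsub : descendants G u w ⊆ Subtype.val '' c.supp := by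
    intro z hz
    obtain ⟨q, hq⟩ := hG.exists_walk_of_mem_descendants hne hz
    have hs : ∀ x ∈ q.support, x ∈ ({u}ᶜ : Set V) := by
      rintro x hx rfl
      exact hq hx
    exact ⟨⟨z, hs z q.end_mem_support⟩,
      SimpleGraph.ConnectedComponent.sound (q.induce _ hs).reachable.symm, rfl⟩
  have hcard : (descendants G u w).ncard ≤ c.supp.ncard :=
    (Set.ncard_le_ncard hsub (Set.toFinite _)).trans (Set.ncard_image_le (Set.toFinite _))
  exact (Nat.cast_le.mpr hcard).trans (hu c)

/-- Along a path `a, b, c` in a tree, the descendants of `c` relative to `b` form a proper subset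
of the descendants of `b` relative to `a`. -/
lemma descendants_ssubset {V : Type*} {G : SimpleGraph V} (hconn : G.Connected)
    (hacyc : G.IsAcyclic) {a b c : V} (hab : G.Adj a b) (hbc : G.Adj b c) (hac : a ≠ c) :
    descendants G b c ⊂ descendants G a b := by
  classical
  refine (Set.ssubset_iff_of_subset fun z hz => ?_).mpr ⟨b, ?_, fun hb => ?_⟩
  · obtain ⟨q, hq⟩ := hconn.exists_walk_of_mem_descendants hbc.ne hz
    refine hacyc.mem_descendants_of_walk hab (.cons hbc q) ?_
    rw [SimpleGraph.Walk.support_cons, List.mem_cons, not_or]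
    refine ⟨hab.ne, fun ha => ?_⟩
    have hmem := hacyc.mem_descendants_of_walk hbc (q.takeUntil a ha)
      fun hb => hq (q.support_takeUntil_subset_support ha hb)
    have := hmem hab.symm.toWalk (by simp [hab.ne'])
    simp [hbc.ne', hac.symm] at this
  · exact fun p _ => p.end_mem_support
  · have := hb .nil .nil
    simp [hbc.ne'] at this

/-- Let `G` be a finite tree with `N` vertices, `v 0` a centroid,
and `v 0, v 1, …, v k` (`k ≥ 1`) a path in `G` (distinct consecutive-adjacent
vertices). Then for every `1 ≤ j ≤ k`, the number of descendants of `v j`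
relative to the root `v (j−1)` is at most `N/2 − j + 1`. -/
theorem stmt8 {V : Type*} [Fintype V] (G : SimpleGraph V)
    (hconn : G.Connected) (hacyc : G.IsAcyclic)
    (k : ℕ) (hk : 1 ≤ k) (v : ℕ → V)
    (hinj : Set.InjOn v (Set.Iic k))
    (hadj : ∀ i < k, G.Adj (v i) (v (i + 1)))
    (hcent : IsCentroid G (v 0)) :
    ∀ j : ℕ, 1 ≤ j → j ≤ k →
      ((descendants G (v (j - 1)) (v j)).ncard : ℝ)
        ≤ (Fintype.card V : ℝ) / 2 - (j : ℝ) + 1 := by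
  intro j hj
  induction j, hj using Nat.le_induction with
  | base =>
    intro _
    have := hcent.ncard_descendants_le hconn (hadj 0 hk).ne
    norm_num
    exact this
  | succ j hj ih =>
    intro hjk
    obtain ⟨i, rfl⟩ := Nat.exists_eq_add_of_le' hj
    have hne : v i ≠ v (i + 1 + 1) := fun h => by
      have := hinj (Set.mem_Iic.mpr (by omega)) (Set.mem_Iic.mpr hjk) h
      omega
    have hlt := Set.ncard_lt_ncard (descendants_ssubset hconn hacyc
      (hadj i (by omega)) (hadj (i + 1) (by omega)) hne) (Set.toFinite _)
    have hle : ((descendants G (v (i + 1)) (v (i + 1 + 1))).ncard : ℝ) + 1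
        ≤ (descendants G (v i) (v (i + 1))).ncard := by exact_mod_cast hlt
    have hi := ih (by omega)
    simp only [Nat.add_sub_cancel] at hi ⊢
    push_cast at hi ⊢
    linarith
end

section
/- Let G be a finite tree with N vertices, let v₀ be a centroid of G, and let v₀, v₁, …, v_k (k ≥ 1) be a path in G, i.e., distinct vertices with v_{i−1} adjacent to v_i for each i. Then for every j with 1 ≤ j ≤ k, the number of descendants of v_{j−1} relative to root v_j is at least N/2 + j − 1, i.e., n_{v_j}(v_{j−1}) ≥ N/2 + j − 1. -/
/-- Passing from an edge `u — w` to the next edge `w — x` of a path in a forest, the descendants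
of `u` relative to `w` together with `w` itself are descendants of `w` relative to `x`. -/
theorem SimpleGraph.IsAcyclic.insert_descendants_subset {V : Type*} {G : SimpleGraph V}
    (hG : G.IsAcyclic) {u w x : V} (hwu : G.Adj w u) (hwx : G.Adj w x) (hux : u ≠ x) :
    insert w (descendants G w u) ⊆ descendants G x w := by
  rintro z (rfl | hz) p hp
  · exact p.end_mem_support
  · by_contra hw
    have hq : (SimpleGraph.Walk.cons hwx p).IsPath := hp.cons hw
    exact hux (by simpa using hG.eq_snd_of_adj_start hq hwu (hz _ hq))

/-- A vertex is not a descendant of another vertex relative to itself as the root. -/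
theorem root_notMem_descendants {V : Type*} (G : SimpleGraph V) {u w : V} (h : w ≠ u) :
    u ∉ descendants G u w := fun hu => by
  simpa [h] using hu SimpleGraph.Walk.nil SimpleGraph.Walk.IsPath.nil

/-- Relative to any other root, a centroid has at least half of the vertices as descendants. -/
theorem IsCentroid.half_card_le_ncard_descendants {V : Type*} [Fintype V] {G : SimpleGraph V}
    {x u : V} (hx : IsCentroid G x) (hne : u ≠ x) :
    (Fintype.card V : ℝ) / 2 ≤ ((descendants G u x).ncard : ℝ) := by
  let c := (G.induce ({x}ᶜ : Set V)).connectedComponentMk ⟨u, hne⟩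
  have hsub : (descendants G u x)ᶜ ⊆ Subtype.val '' c.supp := by
    intro z hz
    simp only [descendants, Set.mem_compl_iff, Set.mem_ofPred_eq, not_forall] at hz
    obtain ⟨p, -, hxp⟩ := hz
    have hp : ∀ y ∈ p.support, y ∈ ({x}ᶜ : Set V) := fun y hy hyx => hxp (hyx ▸ hy)
    exact ⟨⟨z, hp z p.end_mem_support⟩,
      SimpleGraph.ConnectedComponent.sound (p.induce _ hp).reachable.symm, rfl⟩
  have hcard : (descendants G u x)ᶜ.ncard ≤ c.supp.ncard :=
    (Set.ncard_le_ncard hsub).trans (Set.ncard_image_le (Set.toFinite _))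
  have hadd := Set.ncard_add_ncard_compl (descendants G u x)
  rw [Nat.card_eq_fintype_card] at hadd
  have hc := hx c
  rify at hcard hadd
  linarith

/-- Let `G` be a finite tree with `N` vertices, `v 0` a centroid,
and `v 0, v 1, …, v k` (`k ≥ 1`) a path in `G` (distinct consecutive-adjacent
vertices). Then for every `1 ≤ j ≤ k`, the number of descendants of `v (j−1)`
relative to the root `v j` is at least `N/2 + j − 1`. -/
theorem stmt9 {V : Type*} [Fintype V] (G : SimpleGraph V)
    (hconn : G.Connected) (hacyc : G.IsAcyclic)
    (k : ℕ) (hk : 1 ≤ k) (v : ℕ → V)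
    (hinj : Set.InjOn v (Set.Iic k))
    (hadj : ∀ i < k, G.Adj (v i) (v (i + 1)))
    (hcent : IsCentroid G (v 0)) :
    ∀ j : ℕ, 1 ≤ j → j ≤ k →
      (Fintype.card V : ℝ) / 2 + (j : ℝ) - 1
        ≤ ((descendants G (v j) (v (j - 1))).ncard : ℝ) := by
  intro j hj hjk
  induction j, hj using Nat.le_induction with
  | base =>
    have hne : v 1 ≠ v 0 := (hadj 0 hk).ne'
    simpa using hcent.half_card_le_ncard_descendants hne
  | succ j hj ih =>
    obtain ⟨m, rfl⟩ : ∃ m, j = m + 1 := ⟨j - 1, by omega⟩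
    have ih := ih (by omega)
    simp only [Nat.add_sub_cancel] at ih ⊢
    have hne : v m ≠ v (m + 1 + 1) := fun h => by
      have := hinj (Set.mem_Iic.2 (by omega)) (Set.mem_Iic.2 hjk) h
      omega
    have hle := Set.ncard_le_ncard (hacyc.insert_descendants_subset
      (hadj m (by omega)).symm (hadj (m + 1) (by omega)) hne)
    rw [Set.ncard_insert_of_notMem
      (root_notMem_descendants G (hadj m (by omega)).ne)] at hle
    rify at hle
    push_cast at ih ⊢
    linarith
end

section
/- Let G be a finite tree with N vertices, let v₀ be a centroid of G, and let v be any vertex of G at graph distance k from v₀. Then the number of labelings of G whose set of peaks is exactly {v} is at most exp((k − k²)/N) times the number of labelings of G whose set of peaks is exactly {v₀}. -/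
/-- The set of peaks of a labeling `L` of `G` (a bijection from the vertices to
`Fin N`): vertices whose label exceeds the labels of all their neighbors. -/
def peakSet {V : Type*} {n : ℕ} (G : SimpleGraph V) (L : V ≃ Fin n) : Set V :=
  {u : V | ∀ y : V, G.Adj u y → L y < L u}

theorem swap_lt_swap_of_covBy {n : ℕ} {p q a b : Fin n} (hpq : p.val + 1 = q.val) (hab : a < b)
    (h : ¬ (a = p ∧ b = q)) : Equiv.swap p q a < Equiv.swap p q b := by
  simp only [Equiv.swap_apply_def]
  simp only [Fin.ext_iff, Fin.lt_def] at *
  split_ifs <;> omega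

/-- Exchanging two consecutive labels carried by vertices on different sides of a union `A` of
components creates no new peaks. -/
theorem peakSet_trans_swap_subset {V : Type*} {n : ℕ} {H : SimpleGraph V} {A X : Set V}
    (hA : ∀ u w, H.Adj u w → (u ∈ A ↔ w ∈ A)) {p q : Fin n} (hpq : p.val + 1 = q.val)
    {L : V ≃ Fin n} (hL : peakSet H L ⊆ X) (hd : ¬ (L.symm p ∈ A ↔ L.symm q ∈ A)) :
    peakSet H (L.trans (Equiv.swap p q)) ⊆ X := by
  refine subset_trans (fun u hu => ?_) hL
  intro w huw
  by_contra hlt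
  have hlt' : L u < L w :=
    lt_of_le_of_ne (not_lt.1 hlt) fun e => huw.ne (L.injective e)
  refine lt_asymm (hu w huw) ?_
  refine swap_lt_swap_of_covBy hpq hlt' ?_
  rintro ⟨rfl, rfl⟩
  exact hd (by simpa using hA u w huw)

open Finset Classical in
/-- The number of labelings with peaks inside `X` that put label `p` in `A`. -/
noncomputable def labelCount {V : Type*} [Fintype V] {n : ℕ} (H : SimpleGraph V) (A X : Set V)
    (p : Fin n) : ℕ :=
  #{L : V ≃ Fin n | peakSet H L ⊆ X ∧ L.symm p ∈ A}

open Finset Classical in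
theorem labelCount_eq_of_succ {V : Type*} [Fintype V] {n : ℕ} {H : SimpleGraph V} {A : Set V}
    (X : Set V) (hA : ∀ u w, H.Adj u w → (u ∈ A ↔ w ∈ A)) {p q : Fin n}
    (hpq : p.val + 1 = q.val) : labelCount H A X p = labelCount H A X q := by
  let i : (V ≃ Fin n) → (V ≃ Fin n) := fun L =>
    if L.symm p ∈ A ↔ L.symm q ∈ A then L else L.trans (Equiv.swap p q)
  have hi : ∀ L, i (i L) = L := by
    intro L
    by_cases h : L.symm p ∈ A ↔ L.symm q ∈ A
    · simp [i, h]
    · have h' : ¬ (L.symm q ∈ A ↔ L.symm p ∈ A) := fun e => h e.symm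
      ext u
      simp [i, h, h']
  have hX : ∀ L, peakSet H L ⊆ X → peakSet H (i L) ⊆ X := by
    intro L hL
    by_cases h : L.symm p ∈ A ↔ L.symm q ∈ A
    · simpa [i, h] using hL
    · simpa only [i, h, if_false] using peakSet_trans_swap_subset hA hpq hL h
  have hp : ∀ L, (i L).symm p ∈ A ↔ L.symm q ∈ A := by
    intro L
    by_cases h : L.symm p ∈ A ↔ L.symm q ∈ A <;> simp [i, h]
  have hq : ∀ L, (i L).symm q ∈ A ↔ L.symm p ∈ A := by
    intro L
    by_cases h : L.symm p ∈ A ↔ L.symm q ∈ A <;> simp [i, h]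
  refine Finset.card_nbij' i i ?_ ?_ (fun L _ => hi L) (fun L _ => hi L)
  · intro L hL
    simp only [coe_filter, mem_univ, true_and, Set.mem_ofPred_eq] at hL ⊢
    exact ⟨hX L hL.1, (hq L).2 hL.2⟩
  · intro L hL
    simp only [coe_filter, mem_univ, true_and, Set.mem_ofPred_eq] at hL ⊢
    exact ⟨hX L hL.1, (hp L).2 hL.2⟩

theorem labelCount_eq {V : Type*} [Fintype V] {n : ℕ} {H : SimpleGraph V} {A : Set V}
    (X : Set V) (hA : ∀ u w, H.Adj u w → (u ∈ A ↔ w ∈ A)) (p q : Fin n) :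
    labelCount H A X p = labelCount H A X q := by
  have key : ∀ (m : ℕ) (hm : m < n),
      labelCount H A X (⟨m, hm⟩ : Fin n) = labelCount H A X ⟨0, Nat.zero_lt_of_lt hm⟩ := by
    intro m
    induction m with
    | zero => intro _; rfl
    | succ m ih =>
      intro hm
      rw [← ih (by omega)]
      exact (labelCount_eq_of_succ X hA rfl).symm
  exact (key p p.2).trans (key q q.2).symm

open Finset Classical in
theorem mul_labelCount {V : Type*} [Fintype V] {n : ℕ} {H : SimpleGraph V} {A : Set V}
    (X : Set V) (hA : ∀ u w, H.Adj u w → (u ∈ A ↔ w ∈ A)) (q : Fin n) :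
    n * labelCount H A X q = A.ncard * #{L : V ≃ Fin n | peakSet H L ⊆ X} := by
  calc n * labelCount H A X q = ∑ p : Fin n, labelCount H A X p := by
        simp [labelCount_eq X hA _ q]
    _ = ∑ p : Fin n, ∑ L : V ≃ Fin n with peakSet H L ⊆ X, if L.symm p ∈ A then 1 else 0 := by
        simp only [labelCount, ← Finset.filter_filter, Finset.card_filter _ (Finset.filter _ _)]
    _ = ∑ L : V ≃ Fin n with peakSet H L ⊆ X, ∑ p : Fin n, if L.symm p ∈ A then 1 else 0 :=
        Finset.sum_comm
    _ = ∑ L : V ≃ Fin n with peakSet H L ⊆ X, A.ncard := by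
        refine Finset.sum_congr rfl fun L _ => ?_
        rw [Equiv.sum_comp L.symm fun u => if u ∈ A then 1 else 0, ← Finset.card_filter,
          Set.ncard_eq_toFinset_card']
        congr 1
        ext; simp
    _ = _ := by simp [mul_comm]

/-- The vertices on the side of `y` when the edge `xy` is removed. -/
def edgeSide {V : Type*} (G : SimpleGraph V) (x y : V) : Set V :=
  {w | (G.deleteEdges {s(x, y)}).Reachable y w}

theorem reachable_induction {V : Type*} {G : SimpleGraph V} {a : V} {P : V → Prop} (h₀ : P a)
    (hs : ∀ u w, G.Reachable a u → G.Adj u w → P u → P w) {w : V} (h : G.Reachable a w) :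
    P w := by
  have h' := (G.reachable_iff_reflTransGen a w).1 h
  clear h
  induction h' with
  | refl => exact h₀
  | tail h1 h2 ih => exact hs _ _ ((G.reachable_iff_reflTransGen _ _).2 h1) h2 ih

theorem mem_edgeSide_self {V : Type*} (G : SimpleGraph V) (x y : V) : y ∈ edgeSide G x y :=
  SimpleGraph.Reachable.refl _

theorem mem_edgeSide_of_adj {V : Type*} {G : SimpleGraph V} {x y u w : V}
    (hu : u ∈ edgeSide G x y) (huw : G.Adj u w) (hne : s(u, w) ≠ s(x, y)) :
    w ∈ edgeSide G x y :=
  SimpleGraph.Reachable.trans hu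
    (SimpleGraph.Adj.reachable (SimpleGraph.deleteEdges_adj.2 ⟨huw, hne⟩))

theorem edgeSide_induction {V : Type*} {G : SimpleGraph V} {x y : V} {P : V → Prop} (h₀ : P y)
    (hs : ∀ u w, u ∈ edgeSide G x y → w ∈ edgeSide G x y → G.Adj u w → P u → P w) {w : V}
    (h : w ∈ edgeSide G x y) : P w :=
  reachable_induction (G := G.deleteEdges {s(x, y)}) h₀
    (fun u w hu huw => hs u w hu (hu.trans huw.reachable)
      (SimpleGraph.deleteEdges_adj.1 huw).1) h

theorem notMem_edgeSide {V : Type*} {G : SimpleGraph V} (hacyc : G.IsAcyclic) {x y : V}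
    (h : G.Adj x y) : x ∉ edgeSide G x y := by
  intro hx
  have := SimpleGraph.isAcyclic_iff_forall_adj_isBridge.1 hacyc h
  rw [SimpleGraph.isBridge_iff] at this
  exact this hx.symm

theorem ncard_edgeSide_add {V : Type*} [Fintype V] {G : SimpleGraph V} (hconn : G.Connected)
    (hacyc : G.IsAcyclic) {x y : V} (h : G.Adj x y) :
    (edgeSide G x y).ncard + (edgeSide G y x).ncard = Fintype.card V := by
  rw [← Set.ncard_union_eq, ← Nat.card_eq_fintype_card, ← Set.ncard_univ]
  · congr 1
    refine Set.eq_univ_of_forall fun w => ?_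
    refine reachable_induction (G := G) (a := x) (P := fun w => w ∈ edgeSide G x y ∪ edgeSide G y x)
      (Or.inr (mem_edgeSide_self G y x)) ?_ (hconn.preconnected x w)
    intro u w _ huw hu
    by_cases he : s(u, w) = s(x, y)
    · rcases Sym2.eq_iff.1 he with ⟨rfl, rfl⟩ | ⟨rfl, rfl⟩
      · exact Or.inl (mem_edgeSide_self ..)
      · exact Or.inr (mem_edgeSide_self ..)
    · exact hu.imp (fun hu => mem_edgeSide_of_adj hu huw he)
        fun hu => mem_edgeSide_of_adj hu huw (by rwa [Sym2.eq_swap (a := y)])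
  · rw [Set.disjoint_left]
    intro w hw hw'
    refine notMem_edgeSide hacyc h ?_
    rw [edgeSide, Set.mem_ofPred_eq, Sym2.eq_swap] at hw'
    exact SimpleGraph.Reachable.trans hw (SimpleGraph.Reachable.symm hw')

theorem ncard_edgeSide_lt {V : Type*} [Fintype V] {G : SimpleGraph V} (hacyc : G.IsAcyclic)
    {x y z : V} (hyz : G.Adj y z) (hzx : z ≠ x) :
    (edgeSide G y z).ncard < (edgeSide G x y).ncard := by
  have hy := notMem_edgeSide hacyc hyz
  refine Set.ncard_lt_ncard ⟨fun w hw => ?_, fun hsub => hy (hsub (mem_edgeSide_self ..))⟩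
  refine edgeSide_induction (P := fun w => w ∈ edgeSide G x y)
    (mem_edgeSide_of_adj (mem_edgeSide_self ..) hyz ?_) ?_ hw
  · intro he
    rcases Sym2.eq_iff.1 he with ⟨rfl, rfl⟩ | ⟨_, rfl⟩
    · exact hyz.ne rfl
    · exact hzx rfl
  · intro u w hu hw huw ih
    refine mem_edgeSide_of_adj ih huw fun he => ?_
    rcases Sym2.eq_iff.1 he with ⟨rfl, rfl⟩ | ⟨rfl, rfl⟩
    · exact hy hw
    · exact hy hu

theorem IsCentroid.ncard_edgeSide_le {V : Type*} [Fintype V] {G : SimpleGraph V} {x y : V}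
    (hcent : IsCentroid G x) (hacyc : G.IsAcyclic) (h : G.Adj x y) :
    ((edgeSide G x y).ncard : ℝ) ≤ (Fintype.card V : ℝ) / 2 := by
  have hx := notMem_edgeSide hacyc h
  let y' : ({x}ᶜ : Set V) := ⟨y, h.ne'⟩
  refine le_trans ?_ (hcent ((G.induce ({x}ᶜ : Set V)).connectedComponentMk y'))
  rw [← Set.ncard_image_of_injective _ Subtype.val_injective]
  refine Nat.cast_le.2 (Set.ncard_le_ncard fun w hw => ?_)
  refine edgeSide_induction (P := fun w => w ∈ Subtype.val ''
    ((G.induce ({x}ᶜ : Set V)).connectedComponentMk y').supp) ⟨y', rfl, rfl⟩ ?_ hw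
  rintro _ w _ hw huw ⟨u, hu, rfl⟩
  have hadj : (G.induce ({x}ᶜ : Set V)).Adj u ⟨w, fun e => hx (e ▸ hw)⟩ := huw
  refine ⟨⟨w, fun e => hx (e ▸ hw)⟩, ?_, rfl⟩
  rw [SimpleGraph.ConnectedComponent.mem_supp_iff] at hu ⊢
  rw [← hu]
  exact SimpleGraph.ConnectedComponent.sound hadj.symm.reachable

theorem peakSet_eq_singleton_iff {V : Type*} {n : ℕ} {G : SimpleGraph V} (hacyc : G.IsAcyclic)
    {x y : V} (h : G.Adj x y) {q : Fin n} (hq : ∀ i, i ≤ q) (L : V ≃ Fin n) :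
    peakSet G L = {x} ↔
      peakSet (G.deleteEdges {s(x, y)}) L ⊆ {x, y} ∧ L.symm q ∈ edgeSide G y x := by
  have htop : ∀ w, L.symm q ≠ w → L w < L (L.symm q) := by
    intro w hw
    refine lt_of_le_of_ne (by simpa using hq _) fun e => hw (L.injective e.symm)
  have hpeak : ∀ H : SimpleGraph V, L.symm q ∈ peakSet H L := fun H w hw => htop w hw.ne
  constructor
  · intro hL
    have hx : L.symm q = x := by simpa [hL] using hpeak G
    refine ⟨fun u hu => ?_, hx ▸ mem_edgeSide_self ..⟩
    by_contra hne
    simp only [Set.mem_insert_iff, Set.mem_singleton_iff, not_or] at hne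
    have : u ∈ peakSet G L := by
      intro w huw
      refine hu w (SimpleGraph.deleteEdges_adj.2 ⟨huw, fun he => ?_⟩)
      rcases Sym2.eq_iff.1 he with ⟨rfl, rfl⟩ | ⟨rfl, rfl⟩
      · exact hne.1 rfl
      · exact hne.2 rfl
    rw [hL] at this
    exact hne.1 this
  · rintro ⟨hL, hside⟩
    have hx : L.symm q = x := by
      rcases hL (hpeak _) with hx | hy
      · exact hx
      · rw [Set.mem_singleton_iff.1 hy] at hside
        exact absurd hside (notMem_edgeSide hacyc h.symm)
    refine Set.Subset.antisymm (fun u hu => ?_) ?_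
    · have hu' : u ∈ peakSet (G.deleteEdges {s(x, y)}) L :=
        fun w hw => hu w (SimpleGraph.deleteEdges_adj.1 hw).1
      rcases hL hu' with hx | hy
      · exact hx
      · obtain rfl := Set.mem_singleton_iff.1 hy
        have h1 := hu x h.symm
        have h2 := htop u (hx ▸ h.ne)
        rw [hx] at h2
        exact absurd h1 (lt_asymm h2)
    · rw [Set.singleton_subset_iff, ← hx]
      exact hpeak G

open Finset Classical in
theorem card_mul_card_peakSet_eq {V : Type*} [Fintype V] {G : SimpleGraph V}
    (hacyc : G.IsAcyclic) {x y : V} (h : G.Adj x y) {n : ℕ} {q : Fin n} (hq : ∀ i, i ≤ q) :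
    n * Nat.card {L : V ≃ Fin n // peakSet G L = {x}} = (edgeSide G y x).ncard *
      #{L : V ≃ Fin n | peakSet (G.deleteEdges {s(x, y)}) L ⊆ {x, y}} := by
  rw [← mul_labelCount (q := q), labelCount, Nat.card_eq_fintype_card, Fintype.card_subtype]
  · simp only [peakSet_eq_singleton_iff hacyc h hq]
  · intro u w huw
    rw [Sym2.eq_swap] at huw
    exact ⟨fun hu => SimpleGraph.Reachable.trans hu huw.reachable,
      fun hw => SimpleGraph.Reachable.trans hw huw.symm.reachable⟩

/-- Moving the unique peak across an edge changes the number of labelings by the ratio of the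
sizes of the two sides. -/
theorem card_peakSet_mul_ncard_edgeSide {V : Type*} [Fintype V] {G : SimpleGraph V}
    (hacyc : G.IsAcyclic) {x y : V} (h : G.Adj x y) {n : ℕ} {q : Fin n} (hq : ∀ i, i ≤ q) :
    Nat.card {L : V ≃ Fin n // peakSet G L = {y}} * (edgeSide G y x).ncard =
      Nat.card {L : V ≃ Fin n // peakSet G L = {x}} * (edgeSide G x y).ncard := by
  have hx := card_mul_card_peakSet_eq hacyc h hq
  have hy := card_mul_card_peakSet_eq hacyc h.symm hq
  rw [Sym2.eq_swap, Set.pair_comm] at hy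
  have hn : 0 < n := q.pos
  refine Nat.eq_of_mul_eq_mul_left hn ?_
  rw [← mul_assoc, ← mul_assoc, hx, hy]
  ring

theorem card_peakSet_le_of_adj {V : Type*} [Fintype V] {G : SimpleGraph V} (hconn : G.Connected)
    (hacyc : G.IsAcyclic) {x y : V} (h : G.Adj x y) {j : ℝ} (hj : 0 ≤ j)
    (hside : ((edgeSide G x y).ncard : ℝ) ≤ (Fintype.card V : ℝ) / 2 - j) :
    (Nat.card {L : V ≃ Fin (Fintype.card V) // peakSet G L = {y}} : ℝ) ≤
      Real.exp (-(2 * j) / Fintype.card V) *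
        Nat.card {L : V ≃ Fin (Fintype.card V) // peakSet G L = {x}} := by
  have hN : 0 < Fintype.card V := Fintype.card_pos_iff.2 ⟨x⟩
  have hR : (0 : ℝ) < Fintype.card V := by exact_mod_cast hN
  have hmul := card_peakSet_mul_ncard_edgeSide hacyc h
    (q := (⟨Fintype.card V - 1, by omega⟩ : Fin (Fintype.card V)))
    (fun i => by rw [Fin.le_def]; dsimp only; omega)
  have hadd := ncard_edgeSide_add hconn hacyc h
  have hmul' := congrArg (Nat.cast : ℕ → ℝ) hmul
  have hadd' := congrArg (Nat.cast : ℕ → ℝ) hadd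
  push_cast at hmul' hadd'
  generalize (Nat.card {L : V ≃ Fin (Fintype.card V) // peakSet G L = {x}}) = fx at *
  generalize (Nat.card {L : V ≃ Fin (Fintype.card V) // peakSet G L = {y}}) = fy at *
  set N := (Fintype.card V : ℝ)
  set a := ((edgeSide G y x).ncard : ℝ)
  set b := ((edgeSide G x y).ncard : ℝ)
  have ha : N / 2 ≤ a := by linarith
  have hexp : 1 - 2 * j / N ≤ Real.exp (-(2 * j) / N) := by
    have := Real.add_one_le_exp (-(2 * j) / N)
    rw [neg_div] at this ⊢
    linarith
  have hb : b ≤ a * Real.exp (-(2 * j) / N) :=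
    calc b ≤ N / 2 * (1 - 2 * j / N) := by
          refine hside.trans_eq ?_
          field_simp
      _ ≤ N / 2 * Real.exp (-(2 * j) / N) := by gcongr
      _ ≤ a * Real.exp (-(2 * j) / N) := by gcongr
  have ha0 : 0 < a := by linarith
  refine le_of_mul_le_mul_right ?_ ha0
  rw [hmul']
  calc (fx : ℝ) * b ≤ fx * (a * Real.exp (-(2 * j) / N)) := by gcongr
    _ = _ := by ring

theorem card_peakSet_le_of_isPath {V : Type*} [Fintype V] {G : SimpleGraph V}
    (hconn : G.Connected) (hacyc : G.IsAcyclic) {y v : V} (p : G.Walk y v) {x : V}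
    (h : G.Adj x y) (hp : (p.cons h).IsPath) {j : ℝ} (hj : 0 ≤ j)
    (hside : ((edgeSide G x y).ncard : ℝ) ≤ (Fintype.card V : ℝ) / 2 - j) :
    (Nat.card {L : V ≃ Fin (Fintype.card V) // peakSet G L = {v}} : ℝ) ≤
      Real.exp (-((p.length + 1) * (2 * j + p.length)) / Fintype.card V) *
        Nat.card {L : V ≃ Fin (Fintype.card V) // peakSet G L = {x}} := by
  induction p generalizing x j with
  | nil => simpa using card_peakSet_le_of_adj hconn hacyc h hj hside
  | @cons y z v hyz p ih =>
    have hzx : z ≠ x := by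
      rintro rfl
      rw [SimpleGraph.Walk.cons_isPath_iff] at hp
      exact hp.2 (by simp)
    have hlt : ((edgeSide G y z).ncard : ℝ) + 1 ≤ (edgeSide G x y).ncard := by
      exact_mod_cast ncard_edgeSide_lt hacyc hyz hzx
    have h1 := ih hyz hp.of_cons (j := j + 1) (by linarith) (by linarith)
    have h2 := card_peakSet_le_of_adj hconn hacyc h hj hside
    refine h1.trans ((mul_le_mul_of_nonneg_left h2 (Real.exp_pos _).le).trans_eq ?_)
    rw [← mul_assoc, ← Real.exp_add, SimpleGraph.Walk.length_cons]
    congr 2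
    push_cast
    ring

/-- Let `G` be a finite tree with `N` vertices, `v₀` a centroid,
and `v` any vertex at graph distance `k` from `v₀`. Then the number of
labelings of `G` whose set of peaks is exactly `{v}` is at most
`exp((k − k²)/N)` times the number of labelings whose set of peaks is
exactly `{v₀}`. -/
theorem stmt10 {V : Type*} [Fintype V] (G : SimpleGraph V)
    (hconn : G.Connected) (hacyc : G.IsAcyclic)
    (v₀ : V) (hcent : IsCentroid G v₀) (v : V) (k : ℕ) (hk : G.dist v₀ v = k) :
    (Nat.card {L : V ≃ Fin (Fintype.card V) // peakSet G L = {v}} : ℝ)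
      ≤ Real.exp (((k : ℝ) - (k : ℝ) ^ 2) / (Fintype.card V : ℝ)) *
        (Nat.card {L : V ≃ Fin (Fintype.card V) // peakSet G L = {v₀}} : ℝ) := by
  obtain ⟨p, hp, hlen⟩ := hconn.exists_path_of_dist v₀ v
  rw [hk] at hlen
  cases p with
  | nil =>
    obtain rfl : k = 0 := by simpa using hlen.symm
    simp
  | cons h p =>
    have := card_peakSet_le_of_isPath hconn hacyc p h hp le_rfl
      (by simpa using hcent.ncard_edgeSide_le hacyc h)
    refine this.trans_eq ?_
    congr 3
    rw [← hlen, SimpleGraph.Walk.length_cons]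
    push_cast
    ring
end

section
/- Let G be a finite tree with N vertices, let v₀ be a centroid of G, and suppose K ≥ 1 is such that for every integer k ≥ 1 the number of vertices of G at graph distance exactly k from v₀ is at most K. Then for every integer j ≥ 2, the number of labelings of G having exactly one peak, with that peak at graph distance at least j from v₀, is at most (K·N/(j−1))·exp(−(j−1)²/(2N)) times the number of labelings of G whose set of peaks is exactly {v₀}. -/
open Finset in
/-- Two finsets of `Fin n` of the same size are related by a permutation that is monotone on
each of the two pieces cut out by the first of them. -/
theorem exists_perm_map_eq_monotone_on_pieces {n : ℕ} {S T : Finset (Fin n)} (h : #S = #T) :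
    ∃ π : Equiv.Perm (Fin n), (∀ x, π x ∈ T ↔ x ∈ S) ∧
      ∀ x y, (x ∈ S ↔ y ∈ S) → x < y → π x < π y := by
  have hSc : #Sᶜ = n - #S := by simp [card_compl]
  have hTc : #Tᶜ = n - #S := by simp [card_compl, h]
  let e := finSumEquivOfFinset rfl hSc
  let f := finSumEquivOfFinset h.symm hTc
  have hel : ∀ i, e (Sum.inl i) ∈ S := fun i => S.orderEmbOfFin_mem rfl i
  have her : ∀ i, e (Sum.inr i) ∉ S := fun i =>
    mem_compl.1 (Sᶜ.orderEmbOfFin_mem hSc i)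
  have hfl : ∀ i, f (Sum.inl i) ∈ T := fun i => T.orderEmbOfFin_mem h.symm i
  have hfr : ∀ i, f (Sum.inr i) ∉ T := fun i =>
    mem_compl.1 (Tᶜ.orderEmbOfFin_mem hTc i)
  refine ⟨e.symm.trans f, fun x => ?_, fun x y hxy hlt => ?_⟩
  · obtain ⟨i | i, rfl⟩ := e.surjective x
    · simp [hel, hfl]
    · simp [her, hfr]
  · obtain ⟨i | i, rfl⟩ := e.surjective x <;> obtain ⟨j | j, rfl⟩ := e.surjective y
    · have hij : i < j := (S.orderEmbOfFin rfl).lt_iff_lt.1 hlt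
      rw [Equiv.trans_apply, Equiv.trans_apply, e.symm_apply_apply, e.symm_apply_apply]
      exact (T.orderEmbOfFin h.symm).lt_iff_lt.2 hij
    · exact absurd (hxy.1 (hel i)) (her j)
    · exact absurd (hxy.2 (hel j)) (her i)
    · have hij : i < j := (Sᶜ.orderEmbOfFin hSc).lt_iff_lt.1 hlt
      rw [Equiv.trans_apply, Equiv.trans_apply, e.symm_apply_apply, e.symm_apply_apply]
      exact (Tᶜ.orderEmbOfFin hTc).lt_iff_lt.2 hij

open Finset Classical in
/-- If `Q` depends only on the relative order of the labels within `A` and within its complement,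
then the proportion of labelings satisfying `Q` whose top label lies outside `A` is the proportion
of vertices outside `A`. -/
theorem card_labelings_top_notMem_mul {V : Type*} [Fintype V] {n : ℕ}
    (hV : Fintype.card V = n + 1) (A : Finset V) (Q : (V ≃ Fin (n + 1)) → Prop)
    (hQ : ∀ L L' : V ≃ Fin (n + 1),
      (∀ x y, (x ∈ A ↔ y ∈ A) → L x < L y → L' x < L' y) → Q L → Q L') :
    #{L | Q L ∧ L.symm (Fin.last n) ∉ A} * (n + 1) = #{L | Q L} * (n + 1 - #A) := by
  let P : Finset (Fin (n + 1)) → ℕ := fun S => #{L | Q L ∧ A.map L.toEmbedding = S}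
  have hle : ∀ S T : Finset (Fin (n + 1)), #S = #T → P S ≤ P T := by
    intro S T hST
    obtain ⟨π, hπ, hmono⟩ := exists_perm_map_eq_monotone_on_pieces hST
    refine card_le_card_of_injOn (fun L => L.trans π) (fun L hL => ?_) (fun L _ L' _ h => ?_)
    · simp only [coe_filter, mem_univ, true_and, Set.mem_ofPred_eq] at hL ⊢
      obtain ⟨hL, hS⟩ := hL
      have hmem : ∀ x, L x ∈ S ↔ x ∈ A := fun x => by simp [← hS]
      refine ⟨hQ L _ (fun x y hxy hlt => hmono _ _ (by rw [hmem, hmem]; exact hxy) hlt) hL, ?_⟩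
      ext z
      obtain ⟨x, rfl⟩ := (L.trans π).surjective z
      have := hπ (L x)
      simp_all
    · exact Equiv.ext fun x => π.injective (DFunLike.congr_fun h x)
  obtain ⟨c, hc⟩ : ∃ c, ∀ S ∈ powersetCard #A (univ : Finset (Fin (n + 1))), P S = c := by
    obtain ⟨S₀, -, hS₀⟩ := exists_subset_card_eq (s := (univ : Finset (Fin (n + 1)))) (n := #A)
      (by rw [card_univ, Fintype.card_fin, ← hV]; exact card_le_univ A)
    refine ⟨P S₀, fun S hS => ?_⟩
    have hS := (mem_powersetCard.1 hS).2
    exact le_antisymm (hle _ _ (by omega)) (hle _ _ (by omega))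
  have htot : #{L | Q L} = (n + 1).choose #A * c := by
    rw [card_eq_sum_card_fiberwise (f := fun L : V ≃ Fin (n + 1) => A.map L.toEmbedding)
      (t := powersetCard #A univ) (fun L _ => by simp)]
    simp only [filter_filter]
    rw [sum_congr rfl hc]
    simp
  have hbot : #{L | Q L ∧ L.symm (Fin.last n) ∉ A} = n.choose #A * c := by
    have hcard : #(powersetCard #A (univ.erase (Fin.last n))) = n.choose #A := by simp
    rw [card_eq_sum_card_fiberwise (f := fun L : V ≃ Fin (n + 1) => A.map L.toEmbedding)
      (t := powersetCard #A (univ.erase (Fin.last n)))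
      (fun L hL => by
        simp only [coe_filter, mem_univ, true_and, Set.mem_ofPred_eq] at hL
        simp only [mem_coe, mem_powersetCard, card_map, and_true]
        intro z hz
        rw [mem_map_equiv] at hz
        refine mem_erase.2 ⟨?_, mem_univ _⟩
        rintro rfl
        exact hL.2 hz), ← hcard, ← smul_eq_mul, ← sum_const]
    refine sum_congr rfl fun S hS => ?_
    rw [mem_powersetCard] at hS
    rw [← hc S (mem_powersetCard.2 ⟨subset_univ _, hS.2⟩)]
    simp only [P, filter_filter]
    congr 1
    ext L
    simp only [mem_filter, mem_univ, true_and]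
    refine ⟨fun h => ⟨h.1.1, h.2⟩, fun h => ⟨⟨h.1, fun hA => ?_⟩, h.2⟩⟩
    have : Fin.last n ∈ S := by rw [← h.2, mem_map_equiv]; exact hA
    exact (mem_erase.1 (hS.1 this)).1 rfl
  rw [hbot, htot, mul_right_comm, Nat.choose_mul_succ_eq, mul_right_comm]

/-- The unique peak is `u` exactly when every other vertex has a neighbor with a larger label. -/
theorem peakSet_eq_singleton_iff_s11 {V : Type*} [Fintype V] [Nonempty V] {n : ℕ} (G : SimpleGraph V)
    (L : V ≃ Fin n) (u : V) :
    peakSet G L = {u} ↔ ∀ x, x ≠ u → ∃ y, G.Adj x y ∧ L x < L y := by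
  have hiff : ∀ x, x ∉ peakSet G L ↔ ∃ y, G.Adj x y ∧ L x < L y := by
    intro x
    simp only [peakSet, Set.mem_ofPred_eq, not_forall, not_lt, exists_prop]
    refine exists_congr fun y => and_congr_right fun hxy => ⟨fun h => ?_, le_of_lt⟩
    exact lt_of_le_of_ne h fun h' => hxy.ne (L.injective h')
  constructor
  · intro h x hx
    rw [← hiff, h]
    exact hx
  · intro h
    obtain ⟨t, ht⟩ := Finite.exists_max L
    have htu : t = u := by
      by_contra hne
      obtain ⟨y, -, hy⟩ := h t hne
      exact absurd hy (not_lt.2 (ht y))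
    subst htu
    ext x
    simp only [Set.mem_singleton_iff]
    constructor
    · intro hx
      by_contra hne
      exact (hiff x).2 (h x hne) hx
    · rintro rfl
      by_contra hx
      obtain ⟨y, -, hy⟩ := (hiff x).1 hx
      exact absurd hy (not_lt.2 (ht y))

/-- Every vertex of `A` other than `u` has a neighbor in `A` with a larger label. -/
def AscendsIn {V : Type*} {n : ℕ} (G : SimpleGraph V) (L : V ≃ Fin n) (A : Finset V) (u : V) :
    Prop :=
  ∀ x ∈ A, x ≠ u → ∃ y ∈ A, G.Adj x y ∧ L x < L y

open Finset Classical in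
/-- When `uw` is the only edge between `A` and its complement, having `u` as the unique peak
means ascending towards `u` in `A`, towards `w` in the complement, and having the top in `A`. -/
theorem peakSet_eq_singleton_iff_ascendsIn {V : Type*} [Fintype V] {n : ℕ} {G : SimpleGraph V}
    (L : V ≃ Fin (n + 1)) {A : Finset V} {u w : V} (hu : u ∈ A) (hw : w ∉ A) (huw : G.Adj u w)
    (hcross : ∀ x ∈ A, ∀ y ∉ A, G.Adj x y → x = u ∧ y = w) :
    peakSet G L = {u} ↔
      (AscendsIn G L A u ∧ AscendsIn G L Aᶜ w) ∧ L.symm (Fin.last n) ∈ A := by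
  have : Nonempty V := ⟨u⟩
  rw [peakSet_eq_singleton_iff_s11]
  constructor
  · refine fun h => ⟨⟨fun x hx hxu => ?_, fun x hx hxw => ?_⟩, ?_⟩
    · obtain ⟨y, hxy, hlt⟩ := h x hxu
      refine ⟨y, ?_, hxy, hlt⟩
      by_contra hy
      exact hxu (hcross x hx y hy hxy).1
    · rw [mem_compl] at hx
      obtain ⟨y, hxy, hlt⟩ := h x (by rintro rfl; exact hx hu)
      refine ⟨y, mem_compl.2 fun hy => ?_, hxy, hlt⟩
      exact hxw (hcross y hy x hx hxy.symm).2
    · by_contra hA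
      obtain ⟨y, -, hlt⟩ := h (L.symm (Fin.last n)) (fun htu => hA (htu ▸ hu))
      rw [L.apply_symm_apply] at hlt
      exact absurd hlt (not_lt.2 (Fin.le_last _))
  · rintro ⟨⟨hA, hB⟩, htop⟩ x hx
    have htu : L.symm (Fin.last n) = u := by
      by_contra hne
      obtain ⟨y, -, -, hlt⟩ := hA _ htop hne
      rw [L.apply_symm_apply] at hlt
      exact absurd hlt (not_lt.2 (Fin.le_last _))
    by_cases hxA : x ∈ A
    · obtain ⟨y, -, hy⟩ := hA x hxA hx
      exact ⟨y, hy⟩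
    · by_cases hxw : x = w
      · subst hxw
        refine ⟨u, huw.symm, lt_of_le_of_ne ?_ fun h => huw.ne (L.injective h).symm⟩
        rw [← htu, L.apply_symm_apply]
        exact Fin.le_last _
      · obtain ⟨y, -, hy⟩ := hB x (mem_compl.2 hxA) hxw
        exact ⟨y, hy⟩

open Finset Classical in
/-- Moving the unique peak across a bridge `uw`, with `u` on the side `A`. -/
theorem card_peakSet_eq_mul_of_bridge {V : Type*} [Fintype V] {N : ℕ} (hV : Fintype.card V = N)
    {G : SimpleGraph V} {A : Finset V} {u w : V} (hu : u ∈ A) (hw : w ∉ A) (huw : G.Adj u w)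
    (hcross : ∀ x ∈ A, ∀ y ∉ A, G.Adj x y → x = u ∧ y = w) :
    Nat.card {L : V ≃ Fin N // peakSet G L = {w}} * #A =
      Nat.card {L : V ≃ Fin N // peakSet G L = {u}} * (N - #A) := by
  obtain _ | n := N
  · exact absurd hV (Fintype.card_pos_iff.2 ⟨u⟩).ne'
  obtain ⟨Q, hQ⟩ : ∃ Q : (V ≃ Fin (n + 1)) → Prop,
      ∀ L, Q L ↔ AscendsIn G L A u ∧ AscendsIn G L Aᶜ w := ⟨_, fun _ => Iff.rfl⟩
  have hU : Nat.card {L : V ≃ Fin (n + 1) // peakSet G L = {u}} =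
      #{L | Q L ∧ L.symm (Fin.last n) ∈ A} := by
    rw [Nat.card_eq_fintype_card, Fintype.card_subtype]
    simp only [peakSet_eq_singleton_iff_ascendsIn _ hu hw huw hcross, hQ]
  have hW : Nat.card {L : V ≃ Fin (n + 1) // peakSet G L = {w}} =
      #{L | Q L ∧ L.symm (Fin.last n) ∉ A} := by
    rw [Nat.card_eq_fintype_card, Fintype.card_subtype]
    congr 1
    ext L
    rw [mem_filter_univ, mem_filter_univ,
      peakSet_eq_singleton_iff_ascendsIn L (mem_compl.2 hw) (by simpa using hu) huw.symm
      (fun x hx y hy hxy => (hcross y (by simpa using hy) x (mem_compl.1 hx) hxy.symm).symm),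
      compl_compl, mem_compl, hQ, and_comm (a := AscendsIn G L Aᶜ w)]
  have hmain := card_labelings_top_notMem_mul hV A Q (by
    intro L L' hLL' hL
    obtain ⟨h₁, h₂⟩ := (hQ L).1 hL
    refine (hQ L').2 ⟨fun x hx hxu => ?_, fun x hx hxw => ?_⟩
    · obtain ⟨y, hy, hxy, hlt⟩ := h₁ x hx hxu
      exact ⟨y, hy, hxy, hLL' x y (by simp [hx, hy]) hlt⟩
    · obtain ⟨y, hy, hxy, hlt⟩ := h₂ x hx hxw
      exact ⟨y, hy, hxy, hLL' x y (by simp_all) hlt⟩)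
  have hsplit : #{L | Q L} = #{L | Q L ∧ L.symm (Fin.last n) ∈ A} +
      #{L | Q L ∧ L.symm (Fin.last n) ∉ A} := by
    rw [← card_filter_add_card_filter_not (s := ({L | Q L} : Finset (V ≃ Fin (n + 1))))
      (fun L => L.symm (Fin.last n) ∈ A)]
    simp only [filter_filter]
  have hA : #A ≤ n + 1 := hV ▸ card_le_univ A
  rw [hsplit, ← hU, ← hW] at hmain
  obtain ⟨d, hd⟩ := Nat.exists_eq_add_of_le hA
  rw [hd] at hmain ⊢
  simp only [Nat.add_sub_cancel_left] at hmain ⊢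
  linarith

/-- The vertices on the side of `w` after deleting the edge `uw`. -/
def branch {V : Type*} (G : SimpleGraph V) (u w : V) : Set V :=
  {x | (G.deleteEdges {s(u, w)}).Reachable w x}

theorem mem_branch_self {V : Type*} (G : SimpleGraph V) (u w : V) : w ∈ branch G u w :=
  SimpleGraph.Reachable.refl _

theorem notMem_branch {V : Type*} {G : SimpleGraph V} (hG : G.IsAcyclic) {u w : V}
    (huw : G.Adj u w) : u ∉ branch G u w := fun h =>
  SimpleGraph.isBridge_iff.1 (SimpleGraph.isAcyclic_iff_forall_adj_isBridge.1 hG huw) h.symm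

theorem eq_of_adj_of_mem_branch {V : Type*} {G : SimpleGraph V} (hG : G.IsAcyclic) {u w : V}
    (huw : G.Adj u w) {x y : V} (hx : x ∉ branch G u w) (hy : y ∈ branch G u w)
    (hxy : G.Adj x y) : x = u ∧ y = w := by
  have hedge : s(x, y) = s(u, w) := by
    by_contra hne
    refine hx (SimpleGraph.Reachable.trans hy (SimpleGraph.Adj.reachable ?_))
    rw [SimpleGraph.deleteEdges_adj]
    exact ⟨hxy.symm, by rwa [Sym2.eq_swap (a := y)]⟩
  rcases Sym2.eq_iff.1 hedge with h | ⟨-, rfl⟩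
  · exact h
  · exact absurd hy (notMem_branch hG huw)

theorem branch_subset_of_closed {V : Type*} {G : SimpleGraph V} {u w : V} {C : Set V}
    (hw : w ∈ C) (hC : ∀ x ∈ branch G u w, x ∈ C → ∀ y ∈ branch G u w, G.Adj x y → y ∈ C) :
    branch G u w ⊆ C := by
  intro x hx
  have hx' := (SimpleGraph.reachable_iff_reflTransGen _ _).1 hx
  induction hx' with
  | refl => exact hw
  | @tail y z hy hyz ih =>
    have hyb : y ∈ branch G u w := (SimpleGraph.reachable_iff_reflTransGen _ _).2 hy
    exact hC y hyb (ih hyb) z hx (SimpleGraph.deleteEdges_le _ hyz)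

/-- Branches shrink strictly when moving outwards. -/
theorem branch_ssubset_branch {V : Type*} {G : SimpleGraph V} (hG : G.IsAcyclic) {q p u : V}
    (hpu : G.Adj p u) (hqu : q ≠ u) : branch G p u ⊂ branch G q p := by
  have hp := notMem_branch hG hpu
  refine (Set.ssubset_iff_of_subset ?_).2 ⟨p, mem_branch_self G q p, hp⟩
  refine branch_subset_of_closed (SimpleGraph.Adj.reachable ?_) fun x hx hxC y hy hxy =>
    SimpleGraph.Reachable.trans hxC (SimpleGraph.Adj.reachable ?_)
  · rw [SimpleGraph.deleteEdges_adj]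
    refine ⟨hpu, fun h => ?_⟩
    rcases Sym2.eq_iff.1 (Set.mem_singleton_iff.1 h) with ⟨-, h⟩ | ⟨-, h⟩
    · exact hpu.ne h.symm
    · exact hqu h.symm
  · rw [SimpleGraph.deleteEdges_adj]
    refine ⟨hxy, fun h => ?_⟩
    rcases Sym2.eq_iff.1 (Set.mem_singleton_iff.1 h) with ⟨-, h⟩ | ⟨h, -⟩
    · exact hp (h ▸ hy)
    · exact hp (h ▸ hx)

theorem IsCentroid.two_mul_ncard_branch_le {V : Type*} [Fintype V] {G : SimpleGraph V} {v w : V}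
    (hv : IsCentroid G v) (hG : G.IsAcyclic) (hvw : G.Adj v w) :
    2 * (branch G v w).ncard ≤ Fintype.card V := by
  have hmem : ∀ {x}, x ∈ branch G v w → x ∈ ({v}ᶜ : Set V) := fun {x} hx hxv =>
    notMem_branch hG hvw (Set.mem_singleton_iff.1 hxv ▸ hx)
  let w' : ({v}ᶜ : Set V) := ⟨w, hvw.ne'⟩
  let c := (G.induce ({v}ᶜ : Set V)).connectedComponentMk w'
  have hsub : branch G v w ⊆ Subtype.val '' c.supp := by
    refine branch_subset_of_closed ⟨w', rfl, rfl⟩ ?_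
    rintro _ hx ⟨x, hxc, rfl⟩ y hy hxy
    refine ⟨⟨y, hmem hy⟩, ?_, rfl⟩
    rw [SimpleGraph.ConnectedComponent.mem_supp_iff] at hxc ⊢
    rw [← hxc, SimpleGraph.ConnectedComponent.eq]
    exact SimpleGraph.Adj.reachable (G := G.induce ({v}ᶜ : Set V)) hxy.symm
  have hle : (branch G v w).ncard ≤ c.supp.ncard :=
    (Set.ncard_le_ncard hsub).trans (Set.ncard_image_le)
  have hc := hv c
  have : (2 * (branch G v w).ncard : ℝ) ≤ Fintype.card V := by
    have : ((branch G v w).ncard : ℝ) ≤ c.supp.ncard := by exact_mod_cast hle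
    linarith
  exact_mod_cast this

theorem SimpleGraph.Connected.exists_adj_dist_eq {V : Type*} {G : SimpleGraph V}
    (hG : G.Connected) {v u : V} {k : ℕ} (hu : G.dist v u = k + 1) :
    ∃ p, G.Adj p u ∧ G.dist v p = k := by
  obtain ⟨W, hW⟩ := hG.exists_walk_length_eq_dist u v
  rw [SimpleGraph.dist_comm, hu] at hW
  cases W with
  | nil => simp at hW
  | @cons _ p _ hup W =>
    refine ⟨p, hup.symm, ?_⟩
    have h₁ : G.dist p v ≤ k := (SimpleGraph.dist_le W).trans (by simpa using hW.le)
    have h₂ := hG.dist_triangle (u := v) (v := p) (w := u)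
    rw [SimpleGraph.dist_eq_one_iff_adj.2 hup.symm, hu] at h₂
    rw [SimpleGraph.dist_comm] at h₁
    omega

/-- In a tree, a branch hanging off distance `k` from the centroid has at most `N / 2 - k`
vertices. -/
theorem IsCentroid.two_mul_ncard_branch_add_le {V : Type*} [Fintype V] {G : SimpleGraph V}
    {v : V} (hv : IsCentroid G v) (hconn : G.Connected) (hG : G.IsAcyclic) (k : ℕ) :
    ∀ p u, G.Adj p u → G.dist v p = k → G.dist v u = k + 1 →
      2 * (branch G p u).ncard + 2 * k ≤ Fintype.card V := by
  induction k with
  | zero =>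
    intro p u hpu hp _
    obtain rfl := hconn.dist_eq_zero_iff.1 hp
    simpa using hv.two_mul_ncard_branch_le hG hpu
  | succ k ih =>
    intro p u hpu hp hu
    obtain ⟨q, hqp, hq⟩ := hconn.exists_adj_dist_eq hp
    have hqu : q ≠ u := by rintro rfl; omega
    have h₁ := ih q p hqp hq hp
    have h₂ := Set.ncard_lt_ncard (branch_ssubset_branch hG hpu hqu)
    omega

open Finset Classical in
theorem card_peakSet_eq_mul_ncard_branch {V : Type*} [Fintype V] {G : SimpleGraph V}
    (hG : G.IsAcyclic) {u w : V} (huw : G.Adj u w) :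
    Nat.card {L : V ≃ Fin (Fintype.card V) // peakSet G L = {w}} *
        (Fintype.card V - (branch G u w).ncard) =
      Nat.card {L : V ≃ Fin (Fintype.card V) // peakSet G L = {u}} * (branch G u w).ncard := by
  have hcard : (branch G u w).ncard = #(branch G u w).toFinset := Set.ncard_eq_toFinset_card' _
  have h := card_peakSet_eq_mul_of_bridge rfl (A := (branch G u w).toFinsetᶜ)
    (by simpa using notMem_branch hG huw) (by simpa using mem_branch_self G u w) huw
    (fun x hx y hy hxy => eq_of_adj_of_mem_branch hG huw (by simpa using hx) (by simpa using hy)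
      hxy)
  rw [card_compl, ← hcard, Nat.sub_sub_self (hcard ▸ card_le_univ _)] at h
  exact h

/-- Conditioned on a single peak, a vertex at distance `k` from the centroid is less likely to be
the peak than the centroid by a factor `exp (-k (k - 1) / N)`. -/
theorem IsCentroid.card_peakSet_le_exp {V : Type*} [Fintype V] {G : SimpleGraph V}
    {v : V} (hv : IsCentroid G v) (hconn : G.Connected) (hG : G.IsAcyclic) (k : ℕ) :
    ∀ u, G.dist v u = k →
      (Nat.card {L : V ≃ Fin (Fintype.card V) // peakSet G L = {u}} : ℝ) ≤
        Real.exp (-((k : ℝ) * (k - 1)) / Fintype.card V) *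
          Nat.card {L : V ≃ Fin (Fintype.card V) // peakSet G L = {v}} := by
  have hN : (0 : ℝ) < Fintype.card V := by exact_mod_cast Fintype.card_pos_iff.2 ⟨v⟩
  induction k with
  | zero =>
    intro u hu
    obtain rfl := hconn.dist_eq_zero_iff.1 hu
    simp
  | succ k ih =>
    intro u hu
    obtain ⟨p, hpu, hp⟩ := hconn.exists_adj_dist_eq hu
    have hs := hv.two_mul_ncard_branch_add_le hconn hG k p u hpu hp hu
    have hmul := card_peakSet_eq_mul_ncard_branch hG hpu
    have hih := ih p hp
    set N := Fintype.card V
    set s := (branch G p u).ncard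
    set a := Nat.card {L : V ≃ Fin N // peakSet G L = {u}}
    set b := Nat.card {L : V ≃ Fin N // peakSet G L = {p}}
    have hmul' : (a : ℝ) * (N - s) = b * s := by
      rw [← Nat.cast_sub (by omega)]
      exact_mod_cast hmul
    have hs' : (2 * s + 2 * k : ℝ) ≤ N := by exact_mod_cast hs
    have ha : (0 : ℝ) ≤ a := Nat.cast_nonneg _
    have hb : (0 : ℝ) ≤ b := Nat.cast_nonneg _
    have hk : (0 : ℝ) ≤ k := Nat.cast_nonneg _
    have hab : (a : ℝ) ≤ Real.exp (-(2 * k) / N) * b := by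
      have h₁ : (a : ℝ) * N ≤ b * (N - 2 * k) := by nlinarith
      have h₂ : (a : ℝ) ≤ (-(2 * k) / N + 1) * b := by
        rw [div_add_one hN.ne', div_mul_eq_mul_div, le_div_iff₀ hN]
        linarith
      exact h₂.trans (mul_le_mul_of_nonneg_right (Real.add_one_le_exp _) hb)
    calc (a : ℝ) ≤ Real.exp (-(2 * k) / N) * b := hab
      _ ≤ _ := mul_le_mul_of_nonneg_left hih (Real.exp_nonneg _)
      _ = _ := by
        rw [← mul_assoc, ← Real.exp_add]
        congr 2
        push_cast
        ring

/-- A discrete Gaussian tail bound. -/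
theorem sum_Ico_exp_neg_sq_le {N : ℝ} (hN : 0 < N) {j : ℕ} (hj : 2 ≤ j) {M : ℕ} (hM : j ≤ M) :
    ∑ k ∈ Finset.Ico j M, Real.exp (-(k : ℝ) ^ 2 / (2 * N)) ≤
      N / ((j : ℝ) - 1) * (Real.exp (-((j : ℝ) - 1) ^ 2 / (2 * N)) -
        Real.exp (-((M : ℝ) - 1) ^ 2 / (2 * N))) := by
  have hj' : (2 : ℝ) ≤ j := by exact_mod_cast hj
  induction M, hM using Nat.le_induction with
  | base => simp
  | succ M hM ih =>
    have hM' : (j : ℝ) ≤ M := by exact_mod_cast hM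
    rw [Finset.sum_Ico_succ_top hM]
    have hstep : Real.exp (-(M : ℝ) ^ 2 / (2 * N)) ≤ N / ((j : ℝ) - 1) *
        (Real.exp (-((M : ℝ) - 1) ^ 2 / (2 * N)) - Real.exp (-(M : ℝ) ^ 2 / (2 * N))) := by
      have hexp : Real.exp (-((M : ℝ) - 1) ^ 2 / (2 * N)) =
          Real.exp ((2 * M - 1) / (2 * N)) * Real.exp (-(M : ℝ) ^ 2 / (2 * N)) := by
        rw [← Real.exp_add]
        congr 1
        ring
      have h₁ := Real.add_one_le_exp ((2 * (M : ℝ) - 1) / (2 * N))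
      have h₂ : 1 ≤ N / ((j : ℝ) - 1) * (Real.exp ((2 * M - 1) / (2 * N)) - 1) := by
        calc (1 : ℝ) ≤ N / ((j : ℝ) - 1) * ((2 * M - 1) / (2 * N)) := by
              rw [div_mul_div_comm, one_le_div (by nlinarith)]
              nlinarith
          _ ≤ _ := mul_le_mul_of_nonneg_left (by linarith) (div_nonneg hN.le (by linarith))
      rw [hexp]
      nlinarith [Real.exp_pos (-(M : ℝ) ^ 2 / (2 * N))]
    push_cast
    rw [add_sub_cancel_right]
    linarith

/-- Let `G` be a finite tree with `N` vertices, `v₀` a centroid,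
and suppose `K ≥ 1` bounds the number of vertices at graph distance exactly `k`
from `v₀`, for every `k ≥ 1`. Then for every integer `j ≥ 2`, the number of
labelings of `G` having exactly one peak, located at distance at least `j` from
`v₀`, is at most `(K·N/(j−1))·exp(−(j−1)²/(2N))` times the number of labelings
whose set of peaks is exactly `{v₀}`. -/
theorem stmt11 {V : Type*} [Fintype V] (G : SimpleGraph V)
    (hconn : G.Connected) (hacyc : G.IsAcyclic)
    (v₀ : V) (hcent : IsCentroid G v₀) (K : ℕ) (hK : 1 ≤ K)
    (hsphere : ∀ k : ℕ, 1 ≤ k → {u : V | G.dist v₀ u = k}.ncard ≤ K)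
    (j : ℕ) (hj : 2 ≤ j) :
    (Nat.card {L : V ≃ Fin (Fintype.card V) //
        ∃ u : V, peakSet G L = {u} ∧ j ≤ G.dist v₀ u} : ℝ)
      ≤ ((K : ℝ) * (Fintype.card V : ℝ) / ((j : ℝ) - 1)) *
          Real.exp (-((j : ℝ) - 1) ^ 2 / (2 * (Fintype.card V : ℝ))) *
          (Nat.card {L : V ≃ Fin (Fintype.card V) // peakSet G L = {v₀}} : ℝ) := by
  classical
  have hN : (0 : ℝ) < Fintype.card V := by exact_mod_cast Fintype.card_pos_iff.2 ⟨v₀⟩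
  have hj' : (2 : ℝ) ≤ j := by exact_mod_cast hj
  set N := Fintype.card V
  let h : V → ℕ := fun u => Nat.card {L : V ≃ Fin N // peakSet G L = {u}}
  let far : Finset V := {u | j ≤ G.dist v₀ u}
  have hunion : Nat.card {L : V ≃ Fin N // ∃ u : V, peakSet G L = {u} ∧ j ≤ G.dist v₀ u} ≤
      ∑ u ∈ far, h u := by
    simp only [h, Nat.card_eq_fintype_card, Fintype.card_subtype]
    refine (Finset.card_le_card ?_).trans Finset.card_biUnion_le
    intro L hL
    obtain ⟨u, hu, hju⟩ := (Finset.mem_filter_univ _).1 hL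
    exact Finset.mem_biUnion.2 ⟨u, by simpa [far] using hju, by simpa using hu⟩
  have hpoint : ∀ u ∈ far, (h u : ℝ) ≤
      Real.exp (-(G.dist v₀ u : ℝ) ^ 2 / (2 * N)) * h v₀ := by
    intro u hu
    have hd : (2 : ℝ) ≤ G.dist v₀ u := by
      exact_mod_cast hj.trans ((Finset.mem_filter.1 hu).2)
    refine (hcent.card_peakSet_le_exp hconn hacyc _ u rfl).trans
      (mul_le_mul_of_nonneg_right (Real.exp_le_exp.2 ?_) (Nat.cast_nonneg _))
    rw [div_le_div_iff₀ hN (by positivity)]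
    nlinarith [mul_nonneg hN.le (mul_nonneg (Nat.cast_nonneg (α := ℝ) (G.dist v₀ u))
      (sub_nonneg.2 hd))]
  obtain ⟨M, hjM, hM⟩ : ∃ M, j ≤ M ∧ ∀ u, G.dist v₀ u < M :=
    ⟨j + (∑ u, G.dist v₀ u) + 1, by omega, fun u => by
      have := Finset.single_le_sum (f := fun u => G.dist v₀ u) (fun _ _ => Nat.zero_le _)
        (Finset.mem_univ u)
      omega⟩
  have htail : ∑ u ∈ far, Real.exp (-(G.dist v₀ u : ℝ) ^ 2 / (2 * N)) ≤
      K * ∑ k ∈ Finset.Ico j M, Real.exp (-(k : ℝ) ^ 2 / (2 * N)) := by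
    rw [← Finset.sum_fiberwise_of_maps_to (t := Finset.Ico j M) (g := fun u => G.dist v₀ u)
      (fun u hu => Finset.mem_Ico.2 ⟨(Finset.mem_filter.1 hu).2, hM u⟩), Finset.mul_sum]
    refine Finset.sum_le_sum fun k hk => ?_
    have hk := (Finset.mem_Ico.1 hk).1
    rw [Finset.sum_congr rfl (g := fun _ => Real.exp (-(k : ℝ) ^ 2 / (2 * N)))
      (fun u hu => by rw [(Finset.mem_filter.1 hu).2]), Finset.sum_const, nsmul_eq_mul]
    refine mul_le_mul_of_nonneg_right ?_ (Real.exp_nonneg _)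
    have hcard := hsphere k (by omega)
    rw [Set.ncard_eq_toFinset_card'] at hcard
    exact_mod_cast (Finset.card_le_card fun u hu => by
      simpa using (Finset.mem_filter.1 hu).2).trans hcard
  calc (Nat.card {L : V ≃ Fin N // ∃ u : V, peakSet G L = {u} ∧ j ≤ G.dist v₀ u} : ℝ)
      ≤ ∑ u ∈ far, (h u : ℝ) := by exact_mod_cast hunion
    _ ≤ (∑ u ∈ far, Real.exp (-(G.dist v₀ u : ℝ) ^ 2 / (2 * N))) * h v₀ := by
        rw [Finset.sum_mul]
        exact Finset.sum_le_sum hpoint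
    _ ≤ (K * (N / ((j : ℝ) - 1) * Real.exp (-((j : ℝ) - 1) ^ 2 / (2 * N)))) * h v₀ := by
        refine mul_le_mul_of_nonneg_right (htail.trans ?_) (Nat.cast_nonneg _)
        refine mul_le_mul_of_nonneg_left ((sum_Ico_exp_neg_sq_le hN hj hjM).trans ?_)
          (Nat.cast_nonneg _)
        exact mul_le_mul_of_nonneg_left (sub_le_self _ (Real.exp_nonneg _))
          (div_nonneg hN.le (by linarith))
    _ = _ := by ring
end

section
/- For every real z ∈ (0, 1] and all reals T > 0 and T′ > 0, there exists ε₀ with 0 < ε₀ < T such that for every ε ∈ (0, ε₀): ε·z·log z + T·(1 − z)·log(1 − ε/T) + T′·log(T′/(T′ + ε)) − z·ε·log(z·ε/(T′ + ε)) > 0. -/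
/-- For every real `z ∈ (0, 1]` and all reals `T > 0`, `T′ > 0`,
there exists `ε₀` with `0 < ε₀ < T` such that for every `ε ∈ (0, ε₀)`:
`ε·z·log z + T·(1 − z)·log(1 − ε/T) + T′·log(T′/(T′ + ε))
  − z·ε·log(z·ε/(T′ + ε)) > 0`. -/
theorem stmt12 (z : ℝ) (hz0 : 0 < z) (hz1 : z ≤ 1)
    (T T' : ℝ) (hT : 0 < T) (hT' : 0 < T') :
    ∃ ε₀ : ℝ, 0 < ε₀ ∧ ε₀ < T ∧ ∀ ε : ℝ, 0 < ε → ε < ε₀ →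
      0 < ε * z * Real.log z + T * (1 - z) * Real.log (1 - ε / T)
          + T' * Real.log (T' / (T' + ε))
          - z * ε * Real.log (z * ε / (T' + ε)) := by
  refine ⟨min (T / 2) (T' * Real.exp (-(3 / z))), by positivity,
    (min_le_left _ _).trans_lt (by linarith), fun ε hε hlt => ?_⟩
  obtain ⟨hεT, hεT'⟩ := lt_min_iff.1 hlt
  have hlogε : Real.log ε < Real.log T' - 3 / z := by
    have h := Real.log_lt_log hε hεT'
    rw [Real.log_mul hT'.ne' (Real.exp_pos _).ne', Real.log_exp] at h
    linarith
  have hmain : 3 < z * (Real.log T' - Real.log ε) := by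
    have h : 3 / z < Real.log T' - Real.log ε := by linarith
    rwa [div_lt_iff₀' hz0] at h
  have hshrink : -(2 * ε) ≤ T * (1 - z) * Real.log (1 - ε / T) := by
    have hx : ε / T < 1 / 2 := by rw [div_lt_iff₀ hT]; linarith
    have hx0 : 0 < ε / T := by positivity
    have hpos : 0 < 1 - ε / T := by linarith
    have hlog : -(2 * (ε / T)) ≤ Real.log (1 - ε / T) := by
      refine le_trans ?_ (Real.one_sub_inv_le_log_of_pos hpos)
      have h : (1 - ε / T)⁻¹ ≤ 1 + 2 * (ε / T) := by
        rw [inv_le_iff_one_le_mul₀ hpos]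
        nlinarith
      linarith
    have hcoef : 0 ≤ T * (1 - z) := mul_nonneg hT.le (by linarith)
    calc -(2 * ε) ≤ -(2 * ε) * (1 - z) := by nlinarith
      _ = T * (1 - z) * -(2 * (ε / T)) := by field_simp
      _ ≤ _ := mul_le_mul_of_nonneg_left hlog hcoef
  have hgrow : -ε ≤ T' * Real.log (T' / (T' + ε)) := by
    have h := Real.one_sub_inv_le_log_of_pos (show 0 < T' / (T' + ε) by positivity)
    calc -ε = T' * (1 - (T' / (T' + ε))⁻¹) := by field_simp; ring
      _ ≤ _ := mul_le_mul_of_nonneg_left h hT'.le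
  have hsplit : Real.log (z * ε / (T' + ε)) =
      Real.log z + Real.log ε - Real.log (T' + ε) := by
    rw [Real.log_div (by positivity) (by positivity), Real.log_mul hz0.ne' hε.ne']
  have hmono : Real.log T' ≤ Real.log (T' + ε) := Real.log_le_log hT' (by linarith)
  have hdom : 3 * ε < ε * (z * (Real.log (T' + ε) - Real.log ε)) := by
    have h : z * (Real.log T' - Real.log ε) ≤ z * (Real.log (T' + ε) - Real.log ε) :=
      mul_le_mul_of_nonneg_left (by linarith) hz0.le
    nlinarith
  rw [hsplit]
  linarith
end
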